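/- arXiv:2103.14514 — 2 statements merged into one kernel-verified Lean document; each statement's English description precedes it below -/
import Mathlib

section
/- Let D ⊂ ℂⁿ be a bounded B-regular domain and φ, ψ ∈ PSH⁻(D). Then: (i) g_{cφ} = c·g_φ for every constant c > 0; (ii) if φ ≤ ψ + C on D for some constant C, then g_φ ≤ g_ψ; (iii) g_{φ+ψ} ≥ g_φ + g_ψ; (iv) g_{max{φ,ψ}} ≥ max{g_φ, g_ψ}; (v) g_{P(φ,ψ)} ≤ P(g_φ, g_ψ). -/
open MeasureTheory Filter Topology
open scoped ENNReal

noncomputable section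

/-- Complex Euclidean space `ℂⁿ`. -/
abbrev Cn (n : ℕ) : Type := Fin n → ℂ

section Defs

variable {E : Type*} [NormedAddCommGroup E] [NormedSpace ℂ E]

/-- `u` is plurisubharmonic on `Ω`: it is upper semicontinuous on `Ω` (with values in
`EReal`) and on every closed disc of every complex line contained in `Ω` it satisfies the
maximum principle with respect to real parts of complex polynomials (an equivalent form of
the sub-mean value property on complex lines). -/
def PlurisubharmonicOn (u : E → EReal) (Ω : Set E) : Prop :=
  UpperSemicontinuousOn u Ω ∧
  ∀ a b : E, ∀ r : ℝ, 0 < r →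
    (∀ ζ : ℂ, ‖ζ‖ ≤ r → a + ζ • b ∈ Ω) →
    ∀ p : Polynomial ℂ,
      (∀ ζ : ℂ, ‖ζ‖ = r → u (a + ζ • b) ≤ ((Polynomial.eval ζ p).re : EReal)) →
      ∀ ζ : ℂ, ‖ζ‖ ≤ r → u (a + ζ • b) ≤ ((Polynomial.eval ζ p).re : EReal)

/-- Negative plurisubharmonic functions on `Ω` : the class `PSH⁻(Ω)`. -/
def PSHNeg (u : E → EReal) (Ω : Set E) : Prop :=
  PlurisubharmonicOn u Ω ∧ ∀ z ∈ Ω, u z ≤ 0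

/-- A set is pluripolar if it is contained in `{u = -∞}` for some psh `u ≢ -∞`
defined on a neighborhood of the set. -/
def Pluripolar (S : Set E) : Prop :=
  ∃ Ω : Set E, IsOpen Ω ∧ S ⊆ Ω ∧
    ∃ u : E → EReal, PlurisubharmonicOn u Ω ∧ (∃ z ∈ Ω, u z ≠ ⊥) ∧ ∀ z ∈ S, u z = ⊥

/-- Upper semicontinuous regularization (relative to `Ω`) of a function. -/
def uscReg (f : E → EReal) (Ω : Set E) : E → EReal :=
  fun z => Filter.limsup f (nhdsWithin z Ω)

/-- The psh envelope `P(h)` of a function `h` on `Ω`: the usc regularization of the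
supremum of all psh minorants of `h` on `Ω`. -/
def PEnv (h : E → EReal) (Ω : Set E) : E → EReal :=
  uscReg (fun z =>
    ⨆ v ∈ {v : E → EReal | PlurisubharmonicOn v Ω ∧ ∀ x ∈ Ω, v x ≤ h x}, v z) Ω

/-- The rooftop envelope `P(u,v) = P(min{u,v})`. -/
def Rooftop (u v : E → EReal) (Ω : Set E) : E → EReal :=
  PEnv (fun z => min (u z) (v z)) Ω

/-- The Green–Poisson residual function `g_φ`: usc regularization of the supremum of all
negative psh `w` with `w ≤ φ + C_w` on `Ω` for some constant `C_w`. -/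
def gp (φ : E → EReal) (Ω : Set E) : E → EReal :=
  uscReg (fun z =>
    ⨆ w ∈ {w : E → EReal | PSHNeg w Ω ∧ ∃ C : ℝ, ∀ x ∈ Ω, w x ≤ φ x + (C : EReal)}, w z) Ω

/-- The residual Green function `g_φ^o`: usc regularization of the supremum of all
negative psh `w` with `w ≤ φ + O(1)` locally in `Ω`. -/
def gpO (φ : E → EReal) (Ω : Set E) : E → EReal :=
  uscReg (fun z =>
    ⨆ w ∈ {w : E → EReal | PSHNeg w Ω ∧
      ∀ a ∈ Ω, ∃ U ∈ nhds a, ∃ C : ℝ, ∀ x ∈ U ∩ Ω, w x ≤ φ x + (C : EReal)}, w z) Ω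

/-- The residual Poisson function `g_φ^b`: usc regularization of the supremum of all
negative psh `w` with `w ≤ φ + O(1)` in a neighborhood of `∂Ω`. -/
def gpB (φ : E → EReal) (Ω : Set E) : E → EReal :=
  uscReg (fun z =>
    ⨆ w ∈ {w : E → EReal | PSHNeg w Ω ∧
      ∃ U : Set E, IsOpen U ∧ frontier Ω ⊆ U ∧
        ∃ C : ℝ, ∀ x ∈ U ∩ Ω, w x ≤ φ x + (C : EReal)}, w z) Ω

/-- The asymptotic rooftop `P[φ](ψ) = lim*_{C→∞} P(ψ, φ+C)`. -/
def asympRooftop (ψ φ : E → EReal) (Ω : Set E) : E → EReal :=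
  uscReg (fun z => ⨆ C : ℝ, Rooftop ψ (fun x => φ x + (C : EReal)) Ω z) Ω

/-- The unbounded locus `L(φ)` of `φ` in `Ω`: points of `Ω` having no neighborhood on
which `φ` is bounded. -/
def Lset (φ : E → EReal) (Ω : Set E) : Set E :=
  {a | a ∈ Ω ∧ ∀ U ∈ nhds a, ¬ ∃ M : ℝ, ∀ x ∈ U ∩ Ω, -(M : EReal) ≤ φ x ∧ φ x ≤ (M : EReal)}

/-- The boundary unbounded locus `BL(φ)`: boundary points near which `φ` is unbounded. -/
def BLset (φ : E → EReal) (Ω : Set E) : Set E :=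
  {b | b ∈ frontier Ω ∧
    ∀ U ∈ nhds b, ¬ ∃ M : ℝ, ∀ x ∈ U ∩ Ω, -(M : EReal) ≤ φ x ∧ φ x ≤ (M : EReal)}

/-- `PSH_s⁻(Ω)` : negative psh functions with small unbounded locus (both `L(φ)` and
`BL(φ)` pluripolar). -/
def PSHs (φ : E → EReal) (Ω : Set E) : Prop :=
  PSHNeg φ Ω ∧ Pluripolar (Lset φ Ω) ∧ Pluripolar (BLset φ Ω)

/-- `u` is a maximal psh function on the set `U`: it is psh there and for every `G ⋐ U`
and every psh `v` on a neighborhood of `closure G` with `v ≤ u` on `∂G`, one has `v ≤ u`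
on `G`. -/
def MaximalOn (u : E → EReal) (U : Set E) : Prop :=
  PlurisubharmonicOn u U ∧
  ∀ G : Set E, IsOpen G → IsCompact (closure G) → closure G ⊆ U →
    ∀ W : Set E, IsOpen W → closure G ⊆ W →
      ∀ v : E → EReal, PlurisubharmonicOn v W →
        (∀ z ∈ frontier G, v z ≤ u z) → ∀ z ∈ G, v z ≤ u z

/-- B-regularity of a domain: every continuous function on the boundary is the boundary
value of a psh function continuous up to the closure. -/
def BRegular (Ω : Set E) : Prop :=
  ∀ η : E → ℝ, ContinuousOn η (frontier Ω) →
    ∃ u : E → ℝ, PlurisubharmonicOn (fun z => ((u z : ℝ) : EReal)) Ω ∧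
      ContinuousOn u (closure Ω) ∧ ∀ ζ ∈ frontier Ω, u ζ = η ζ

/-- Pseudoconvexity: existence of a continuous psh exhaustion function. -/
def Pseudoconvex (Ω : Set E) : Prop :=
  IsOpen Ω ∧ ∃ u : E → ℝ, ContinuousOn u Ω ∧
    PlurisubharmonicOn (fun z => ((u z : ℝ) : EReal)) Ω ∧
    ∀ c : ℝ, IsCompact {z | z ∈ Ω ∧ u z ≤ c}

/-- Hyperconvexity: existence of a negative psh exhaustion function. -/
def Hyperconvex (Ω : Set E) : Prop :=
  ∃ ρ : E → EReal, PlurisubharmonicOn ρ Ω ∧ (∀ z ∈ Ω, ρ z < 0) ∧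
    ∀ c : ℝ, c < 0 →
      IsCompact (closure {z | z ∈ Ω ∧ ρ z ≤ (c : EReal)}) ∧
      closure {z | z ∈ Ω ∧ ρ z ≤ (c : EReal)} ⊆ Ω

/-- `H` is the least maximal psh majorant (`fb φ`) of `φ` on `Ω` (within `PSH⁻(Ω)`). -/
def IsLeastMaxMajorant (φ H : E → EReal) (Ω : Set E) : Prop :=
  MaximalOn H Ω ∧ (∀ z ∈ Ω, H z ≤ 0) ∧ (∀ z ∈ Ω, φ z ≤ H z) ∧
  ∀ H' : E → EReal, MaximalOn H' Ω → (∀ z ∈ Ω, H' z ≤ 0) → (∀ z ∈ Ω, φ z ≤ H' z) →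
    ∀ z ∈ Ω, H z ≤ H' z

/-- Extended-real logarithm, with `log 0 = -∞`. -/
def elog (x : ℝ) : EReal := if x ≤ 0 then (⊥ : EReal) else ((Real.log x : ℝ) : EReal)

end Defs

section MA

/-- Real second directional derivative `D²u(z)(v,w)`. -/
def reB (n : ℕ) (u : Cn n → ℝ) (z v w : Cn n) : ℝ :=
  fderiv ℝ (fun x => fderiv ℝ u x w) z v

/-- Entry `∂²u/∂z_j∂z̄_k` of the complex Hessian of a (C²) function `u`. -/
def cHessEntry (n : ℕ) (u : Cn n → ℝ) (z : Cn n) (j k : Fin n) : ℂ :=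
  (1 / 4 : ℂ) *
    ( ((reB n u z ((Pi.single j (1 : ℂ) : Cn n)) ((Pi.single k (1 : ℂ) : Cn n)) : ℝ) : ℂ)
    + ((reB n u z ((Pi.single j Complex.I : Cn n)) ((Pi.single k Complex.I : Cn n)) : ℝ) : ℂ)
    + Complex.I *
      ( ((reB n u z ((Pi.single j (1 : ℂ) : Cn n)) ((Pi.single k Complex.I : Cn n)) : ℝ) : ℂ)
      - ((reB n u z ((Pi.single j Complex.I : Cn n)) ((Pi.single k (1 : ℂ) : Cn n)) : ℝ) : ℂ)))

/-- Density of the Monge–Ampère measure `(dd^c u)ⁿ` of a smooth function `u`. -/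
def maDensity (n : ℕ) (u : Cn n → ℝ) (z : Cn n) : ℝ :=
  (4 : ℝ) ^ n * (n.factorial : ℝ) * (Matrix.det (Matrix.of fun j k => cHessEntry n u z j k)).re

/-- `μ` is the Bedford–Taylor Monge–Ampère measure `(dd^c u)ⁿ` of `u` on `Ω`:
it is locally finite on `Ω`, carried by `Ω`, and for every open `U ⊆ Ω` and every
decreasing sequence of smooth psh functions on `U` converging pointwise to `u`, the
corresponding smooth Monge–Ampère measures converge to `μ` against test functions
supported in `U`. -/
def IsMAMeasure (n : ℕ) (u : Cn n → EReal) (Ω : Set (Cn n)) (μ : Measure (Cn n)) : Prop :=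
  μ Ωᶜ = 0 ∧ (∀ K : Set (Cn n), IsCompact K → K ⊆ Ω → μ K ≠ ⊤) ∧
  ∀ U : Set (Cn n), IsOpen U → U ⊆ Ω →
    ∀ v : ℕ → Cn n → ℝ,
      (∀ k, ContDiffOn ℝ (⊤ : ℕ∞) (v k) U) →
      (∀ k, PlurisubharmonicOn (fun z => ((v k z : ℝ) : EReal)) U) →
      (∀ k, ∀ z ∈ U, v (k + 1) z ≤ v k z) →
      (∀ z ∈ U, (⨅ k, ((v k z : ℝ) : EReal)) = u z) →
      ∀ f : Cn n → ℝ, Continuous f → HasCompactSupport f → tsupport f ⊆ U →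
        Filter.Tendsto (fun k => ∫ z, f z * maDensity n (v k) z) Filter.atTop
          (nhds (∫ z, f z ∂μ))

/-- The Cegrell class `E₀(Ω)`: bounded negative psh functions with zero boundary values
and finite total Monge–Ampère mass. -/
def ClassE0 (n : ℕ) (Ω : Set (Cn n)) (φ : Cn n → EReal) : Prop :=
  PSHNeg φ Ω ∧ (∃ M : ℝ, ∀ z ∈ Ω, -(M : EReal) ≤ φ z) ∧
  (∀ ζ ∈ frontier Ω, Filter.Tendsto φ (nhdsWithin ζ Ω) (nhds (0 : EReal))) ∧
  ∃ μ : Measure (Cn n), IsMAMeasure n φ Ω μ ∧ μ Ω ≠ ⊤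

/-- The Cegrell class `E(Ω)`: negative psh functions that are locally decreasing limits
of functions of `E₀(Ω)` with uniformly bounded total Monge–Ampère masses. -/
def ClassE (n : ℕ) (Ω : Set (Cn n)) (φ : Cn n → EReal) : Prop :=
  PSHNeg φ Ω ∧
  ∀ z ∈ Ω, ∃ U : Set (Cn n), IsOpen U ∧ z ∈ U ∧ U ⊆ Ω ∧
    ∃ h : ℕ → Cn n → EReal, ∃ M : ℝ≥0∞, M ≠ ⊤ ∧
      (∀ j, ClassE0 n Ω (h j)) ∧
      (∀ j, ∀ x ∈ Ω, h (j + 1) x ≤ h j x) ∧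
      (∀ x ∈ U, (⨅ j, h j x) = φ x) ∧
      (∀ j, ∀ μ : Measure (Cn n), IsMAMeasure n (h j) Ω μ → μ Ω ≤ M)

/-- The Cegrell class `N(Ω) = {w ∈ E(Ω) : fb w = 0}`. -/
def ClassN (n : ℕ) (Ω : Set (Cn n)) : Set (Cn n → EReal) :=
  {w | ClassE n Ω w ∧ IsLeastMaxMajorant w 0 Ω}

/-- The Cegrell class `F(Ω) = {w ∈ E(Ω) : ∫ (dd^c w)ⁿ < ∞ and fb w = 0}`. -/
def ClassF (n : ℕ) (Ω : Set (Cn n)) : Set (Cn n → EReal) :=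
  {w | ClassE n Ω w ∧ IsLeastMaxMajorant w 0 Ω ∧
    ∀ μ : Measure (Cn n), IsMAMeasure n w Ω μ → μ Ω ≠ ⊤}

/-- Membership `φ ∈ K(Ω, H)`: `φ ∈ E(Ω)` and `H + w ≤ φ ≤ H` for some `w ∈ K`. -/
def InClassRel (n : ℕ) (Ω : Set (Cn n)) (K : Set (Cn n → EReal)) (H φ : Cn n → EReal) : Prop :=
  ClassE n Ω φ ∧ ∃ w ∈ K, ∀ z ∈ Ω, H z + w z ≤ φ z ∧ φ z ≤ H z

/-- The annulus `A = {1 < |ζ| < e}`. -/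
def annA : Set ℂ := {ζ : ℂ | 1 < ‖ζ‖ ∧ ‖ζ‖ < Real.exp 1}

/-- The class `W(u₀,u₁)` of subgeodesics: negative psh functions on `Ω × A` with boundary
limsups dominated by `u₀` on `|ζ| = 1` and by `u₁` on `|ζ| = e`. -/
def geodClass (n : ℕ) (Ω : Set (Cn n)) (u0 u1 : Cn n → EReal) : Set (Cn n × ℂ → EReal) :=
  {u | PSHNeg u (Ω ×ˢ annA) ∧
    (∀ z ∈ Ω, Filter.limsup (fun ζ : ℂ => u (z, ζ))
        ((nhds (1 : ℝ)).comap (fun ζ : ℂ => ‖ζ‖) ⊓ Filter.principal annA) ≤ u0 z) ∧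
    (∀ z ∈ Ω, Filter.limsup (fun ζ : ℂ => u (z, ζ))
        ((nhds (Real.exp 1)).comap (fun ζ : ℂ => ‖ζ‖) ⊓ Filter.principal annA) ≤ u1 z)}

/-- The geodesic `u_t(z) = P_W(z, e^t)`, the Perron envelope of the class `W(u₀,u₁)`. -/
def geodesic (n : ℕ) (Ω : Set (Cn n)) (u0 u1 : Cn n → EReal) (t : ℝ) (z : Cn n) : EReal :=
  ⨆ u ∈ geodClass n Ω u0 u1, u (z, ((Real.exp t : ℝ) : ℂ))

/-- The Monge–Ampère capacity `Cap(S) = sup {∫_S (dd^c u)ⁿ : u psh, -1 ≤ u ≤ 0}`. -/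
def MACap (n : ℕ) (Ω : Set (Cn n)) (S : Set (Cn n)) : ℝ≥0∞ :=
  ⨆ u ∈ {u : Cn n → EReal | PlurisubharmonicOn u Ω ∧ ∀ z ∈ Ω, -1 ≤ u z ∧ u z ≤ 0},
    ⨆ μ ∈ {μ : Measure (Cn n) | IsMAMeasure n u Ω μ}, μ S

/-- Convergence `u t → g` in capacity as `t → t₀` within `(0,1)`. -/
def TendstoInCap (n : ℕ) (Ω : Set (Cn n)) (u : ℝ → Cn n → EReal) (g : Cn n → EReal)
    (t0 : ℝ) : Prop :=
  ∀ ε : ℝ, 0 < ε → ∀ K : Set (Cn n), IsCompact K → K ⊆ Ω →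
    Filter.Tendsto
      (fun t => MACap n Ω
        {z | z ∈ K ∧ ¬ (u t z ≤ g z + (ε : EReal) ∧ g z ≤ u t z + (ε : EReal))})
      (nhdsWithin t0 (Set.Ioo (0 : ℝ) 1)) (nhds (0 : ℝ≥0∞))

/-- Convergence `u t → g` in `L¹_loc(Ω)` as `t → t₀` within `(0,1)`. -/
def TendstoL1loc (n : ℕ) (Ω : Set (Cn n)) (u : ℝ → Cn n → EReal) (g : Cn n → EReal)
    (t0 : ℝ) : Prop :=
  ∀ K : Set (Cn n), IsCompact K → K ⊆ Ω →
    Filter.Tendsto (fun t => ∫⁻ z in K, ENNReal.ofReal |(u t z).toReal - (g z).toReal|)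
      (nhdsWithin t0 (Set.Ioo (0 : ℝ) 1)) (nhds (0 : ℝ≥0∞))

end MA

theorem norm_toCircle {T : ℝ} (t : AddCircle T) : ‖(t.toCircle : ℂ)‖ = 1 :=
  Circle.norm_coe _

/-- On the unit circle, the real part of a trigonometric polynomial is the real part of a
polynomial. -/
theorem exists_polynomial_re_eq_of_mem_span_fourier {f : C(AddCircle (1 : ℝ), ℂ)}
    (hf : f ∈ Submodule.span ℂ (Set.range (@fourier (1 : ℝ)))) (c : ℂ) :
    ∃ q : Polynomial ℂ, ∀ t : AddCircle (1 : ℝ),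
      (c * f t).re = (q.eval (t.toCircle : ℂ)).re := by
  induction hf using Submodule.span_induction generalizing c with
  | mem f hf =>
    obtain ⟨m, rfl⟩ := hf
    obtain ⟨k, rfl | rfl⟩ := m.eq_nat_or_neg
    · refine ⟨.C c * .X ^ k, fun t => ?_⟩
      simp [fourier_apply, AddCircle.toCircle_nsmul]
    · refine ⟨.C (starRingEnd ℂ c) * .X ^ k, fun t => ?_⟩
      rw [fourier_neg, ← Complex.conj_re]
      simp [fourier_apply, AddCircle.toCircle_nsmul]
  | zero => exact ⟨0, by simp⟩
  | add f g _ _ hf hg =>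
    obtain ⟨p, hp⟩ := hf c
    obtain ⟨q, hq⟩ := hg c
    exact ⟨p + q, fun t => by
      rw [ContinuousMap.add_apply, mul_add, Complex.add_re, hp, hq, Polynomial.eval_add,
        Complex.add_re]⟩
  | smul a f _ hf =>
    obtain ⟨p, hp⟩ := hf (c * a)
    exact ⟨p, fun t => by rw [← hp t, ContinuousMap.smul_apply, smul_eq_mul, mul_assoc]⟩

/-- Real continuous functions on the circle are uniform limits of real parts of polynomials. -/
theorem exists_polynomial_re_near (g : C(AddCircle (1 : ℝ), ℝ)) {ε : ℝ} (hε : 0 < ε) :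
    ∃ q : Polynomial ℂ, ∀ t, |g t - (q.eval (t.toCircle : ℂ)).re| < ε := by
  let G : C(AddCircle (1 : ℝ), ℂ) := ⟨fun t => (g t : ℂ), by fun_prop⟩
  have hG : G ∈ (Submodule.span ℂ (Set.range (@fourier (1 : ℝ)))).topologicalClosure := by
    simp [span_fourier_closure_eq_top]
  obtain ⟨f, hf, hfG⟩ := Metric.mem_closure_iff.1 hG ε hε
  obtain ⟨q, hq⟩ := exists_polynomial_re_eq_of_mem_span_fourier hf 1
  refine ⟨q, fun t => ?_⟩
  rw [← hq t, one_mul]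
  calc |g t - (f t).re| = |(G t - f t).re| := by simp [G]
    _ ≤ ‖G t - f t‖ := Complex.abs_re_le_norm _
    _ ≤ dist G f := by rw [← dist_eq_norm]; exact ContinuousMap.dist_apply_le_dist t
    _ < ε := hfG

theorem integral_eval_toCircle (q : Polynomial ℂ) :
    ∫ t : AddCircle (1 : ℝ), q.eval (t.toCircle : ℂ) ∂AddCircle.haarAddCircle = q.eval 0 := by
  have hint (q : Polynomial ℂ) : Integrable (fun t : AddCircle (1 : ℝ) => q.eval (t.toCircle : ℂ))
      AddCircle.haarAddCircle :=
    (ContinuousMap.mk (fun t : AddCircle (1 : ℝ) => q.eval (t.toCircle : ℂ))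
      (q.continuous.comp (continuous_subtype_val.comp
        AddCircle.continuous_toCircle))).continuous.integrable_of_hasCompactSupport
      (HasCompactSupport.of_compactSpace _)
  induction q using Polynomial.induction_on' with
  | add p q hp hq =>
    simp only [Polynomial.eval_add] at *
    rw [integral_add (hint p) (hint q), hp, hq]
  | monomial k a =>
    have h := congrFun (fourierCoeff_fourier (T := (1 : ℝ)) k) 0
    simp only [fourierCoeff, neg_zero, fourier_zero, one_smul] at h
    have h2 (t : AddCircle (1 : ℝ)) : (t.toCircle : ℂ) ^ k = fourier (k : ℤ) t := by
      simp [fourier_apply, AddCircle.toCircle_nsmul]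
    simp only [Polynomial.eval_monomial, integral_const_mul, h2, h]
    rcases Nat.eq_zero_or_pos k with rfl | hk
    · simp
    · simp [hk.ne', eq_comm]

/-- Katětov–Tong insertion of a continuous function between `u` and `h - v`, up to `ε`. -/
theorem exists_continuous_between {X : Type*} [TopologicalSpace X] [NormalSpace X]
    [ParacompactSpace X] {u v : X → EReal} {h : X → ℝ} (hu : UpperSemicontinuous u)
    (hv : UpperSemicontinuous v) (hh : Continuous h) (hu' : ∀ x, u x ≠ ⊤) (hv' : ∀ x, v x ≠ ⊤)
    (huv : ∀ x, u x + v x ≤ (h x : EReal)) {ε : ℝ} (hε : 0 < ε) :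
    ∃ k : C(X, ℝ), ∀ x, u x < (k x : EReal) ∧ v x < ((h x + ε - k x : ℝ) : EReal) := by
  let S : X → Set ℝ := fun x => {c | u x < (c : EReal) ∧ v x < ((h x + ε - c : ℝ) : EReal)}
  have h1 (x : X) : Convex ℝ (S x) := by
    refine Set.OrdConnected.convex ⟨fun a ha b hb c hc => ⟨ha.1.trans_le ?_, hb.2.trans_le ?_⟩⟩
    · exact_mod_cast hc.1
    · exact_mod_cast by linarith [hc.2]
  have h2 (x : X) : ∃ c, ∀ᶠ y in 𝓝 x, c ∈ S y := by
    obtain ⟨c, hc1, d, hd, hd2⟩ : ∃ c : ℝ, u x < (c : EReal) ∧ ∃ d : ℝ, v x < (d : EReal) ∧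
        d < h x + ε - c := by
      have h1 := huv x
      have h2 := hu' x
      have h3 := hv' x
      generalize u x = U at *
      generalize v x = V at *
      induction U with
      | top => exact absurd rfl h2
      | bot =>
        induction V with
        | top => exact absurd rfl h3
        | bot => exact ⟨h x, EReal.bot_lt_coe _, 0, EReal.bot_lt_coe _, by linarith⟩
        | coe b => exact ⟨h x - b - 1, EReal.bot_lt_coe _, b + 1 / 2, by norm_cast; linarith,
            by linarith⟩
      | coe a =>
        induction V with
        | top => exact absurd rfl h3
        | bot => exact ⟨a + 1, by norm_cast; linarith, h x - a - 2, EReal.bot_lt_coe _,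
            by linarith⟩
        | coe b =>
          norm_cast at h1
          exact ⟨a + ε / 4, by norm_cast; linarith, b + ε / 4, by norm_cast; linarith,
            by linarith⟩
    refine ⟨c, ?_⟩
    filter_upwards [hu x c hc1, hv x d hd, (hh.continuousAt (x := x)).eventually_const_lt
      (show d - ε + c < h x by linarith)] with y h1 h2 h3
    exact ⟨h1, h2.trans (by norm_cast; linarith)⟩
  obtain ⟨g, hg⟩ := exists_continuous_forall_mem_convex_of_local_const h1 h2
  exact ⟨g, hg⟩

section Circle

variable {E : Type*} [NormedAddCommGroup E] [NormedSpace ℂ E] {Ω : Set E} {u v : E → EReal}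

theorem PSHNeg.ne_top (hu : PSHNeg u Ω) {x : E} (hx : x ∈ Ω) : u x ≠ ⊤ :=
  ne_top_of_le_ne_top EReal.zero_ne_top (hu.2 x hx)

theorem continuous_circle_param (a b : E) (r : ℝ) :
    Continuous fun t : AddCircle (1 : ℝ) => a + ((r : ℂ) * (t.toCircle : ℂ)) • b := by
  have : Continuous fun t : AddCircle (1 : ℝ) => (t.toCircle : ℂ) :=
    continuous_subtype_val.comp AddCircle.continuous_toCircle
  fun_prop

theorem PlurisubharmonicOn.usc_circle (hu : PlurisubharmonicOn u Ω) {a b : E} {r : ℝ}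
    (hr : 0 < r) (hd : ∀ ζ : ℂ, ‖ζ‖ ≤ r → a + ζ • b ∈ Ω) :
    UpperSemicontinuous fun t : AddCircle (1 : ℝ) =>
      u (a + ((r : ℂ) * (t.toCircle : ℂ)) • b) := by
  rw [← upperSemicontinuousOn_univ_iff]
  exact hu.1.comp (continuous_circle_param a b r).continuousOn
    fun t _ => hd _ (by simp [norm_toCircle, abs_of_pos hr])

theorem PlurisubharmonicOn.le_re_of_circle (hu : PlurisubharmonicOn u Ω) {a b : E} {r : ℝ}
    (hr : 0 < r) (hd : ∀ ζ : ℂ, ‖ζ‖ ≤ r → a + ζ • b ∈ Ω) (p : Polynomial ℂ)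
    (hp : ∀ t : AddCircle (1 : ℝ), u (a + ((r : ℂ) * (t.toCircle : ℂ)) • b) ≤
      ((p.eval ((r : ℂ) * (t.toCircle : ℂ))).re : EReal)) {ζ : ℂ} (hζ : ‖ζ‖ ≤ r) :
    u (a + ζ • b) ≤ ((p.eval ζ).re : EReal) := by
  refine hu.2 a b r hr hd p (fun ξ hξ => ?_) ζ hζ
  have hr' : (r : ℂ) ≠ 0 := by exact_mod_cast hr.ne'
  let e : Circle := ⟨ξ / r, by simp [Submonoid.unitSphere, hξ, abs_of_pos hr, hr.ne']⟩
  obtain ⟨t, ht⟩ := (AddCircle.homeomorphCircle (one_ne_zero' ℝ)).surjective e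
  have h : (r : ℂ) * (t.toCircle : ℂ) = ξ := by
    have : t.toCircle = e := (AddCircle.homeomorphCircle_apply _ t).symm.trans ht
    rw [this]
    exact mul_div_cancel₀ _ hr'
  simpa only [h] using hp t

theorem PSHNeg.add (hu : PSHNeg u Ω) (hv : PSHNeg v Ω) : PSHNeg (fun x => u x + v x) Ω := by
  refine ⟨⟨hu.1.1.add' hv.1.1 fun x hx => EReal.continuousAt_add (.inl (hu.ne_top hx))
    (.inr (hv.ne_top hx)), ?_⟩, fun z hz => add_nonpos (hu.2 z hz) (hv.2 z hz)⟩
  intro a b r hr hd p hp ζ hζ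
  have hmem (t : AddCircle (1 : ℝ)) : a + ((r : ℂ) * (t.toCircle : ℂ)) • b ∈ Ω :=
    hd _ (by simp [norm_toCircle, abs_of_pos hr])
  rw [← EReal.le_of_forall_lt_iff_le]
  intro s hs
  obtain ⟨ε, hε, rfl⟩ : ∃ ε > 0, (p.eval ζ).re + 3 * ε = s :=
    ⟨(s - (p.eval ζ).re) / 3, by linarith [EReal.coe_lt_coe_iff.1 hs], by ring⟩
  obtain ⟨k, hk⟩ := exists_continuous_between (h := fun t : AddCircle (1 : ℝ) =>
      (p.eval ((r : ℂ) * (t.toCircle : ℂ))).re) (hu.1.usc_circle hr hd) (hv.1.usc_circle hr hd)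
    (Complex.continuous_re.comp (p.continuous.comp (continuous_const.mul
      (continuous_subtype_val.comp AddCircle.continuous_toCircle))))
    (fun t => hu.ne_top (hmem t)) (fun t => hv.ne_top (hmem t))
    (fun t => hp _ (by simp [norm_toCircle, abs_of_pos hr])) hε
  obtain ⟨q₀, hq₀⟩ := exists_polynomial_re_near k hε
  have hr' : (r : ℂ) ≠ 0 := by exact_mod_cast hr.ne'
  let q : Polynomial ℂ := q₀.comp (.C (r : ℂ)⁻¹ * .X)
  have hq (t : AddCircle (1 : ℝ)) : |k t - (q.eval ((r : ℂ) * (t.toCircle : ℂ))).re| < ε := by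
    simpa [q, ← mul_assoc, hr'] using hq₀ t
  have h1 := hu.1.le_re_of_circle hr hd (q + .C (ε : ℂ)) (fun t => (hk t).1.le.trans (by
    have := abs_lt.1 (hq t)
    simp only [Polynomial.eval_add, Polynomial.eval_C, Complex.add_re, Complex.ofReal_re]
    norm_cast; linarith)) hζ
  have h2 := hv.1.le_re_of_circle hr hd (p - q + .C ((2 * ε : ℝ) : ℂ))
    (fun t => (hk t).2.le.trans (by
      have := abs_lt.1 (hq t)
      simp only [Polynomial.eval_add, Polynomial.eval_sub, Polynomial.eval_C, Complex.add_re,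
        Complex.sub_re, Complex.ofReal_re]
      norm_cast; linarith)) hζ
  refine (add_le_add h1 h2).trans (le_of_eq ?_)
  simp only [Polynomial.eval_add, Polynomial.eval_sub, Polynomial.eval_C, Complex.add_re,
    Complex.sub_re, Complex.ofReal_re]
  norm_cast; ring_nf

/-- The sub-mean value inequality on circles. -/
theorem PSHNeg.lintegral_circle_le (hu : PSHNeg u Ω) {a b : E}
    (hd : ∀ ζ : ℂ, ‖ζ‖ ≤ 1 → a + ζ • b ∈ Ω) :
    ∫⁻ t : AddCircle (1 : ℝ), (-u (a + (t.toCircle : ℂ) • b)).toENNReal ∂AddCircle.haarAddCircle ≤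
      (-u a).toENNReal := by
  have hmem (t : AddCircle (1 : ℝ)) : a + (t.toCircle : ℂ) • b ∈ Ω := hd _ (by simp [norm_toCircle])
  have husc := hu.1.usc_circle one_pos hd
  simp only [Complex.ofReal_one, one_mul] at husc
  rw [lintegral_eq_nnreal]
  refine iSup₂_le fun f hf => ?_
  have hfin : ∫⁻ t, (f t : ℝ≥0∞) ∂(AddCircle.haarAddCircle (T := 1)) ≠ ∞ := by
    obtain ⟨C, hC⟩ := f.finite_range.bddAbove
    refine ne_top_of_le_ne_top (b := ∫⁻ _, (C : ℝ≥0∞) ∂(AddCircle.haarAddCircle (T := 1)))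
      (by simp) (lintegral_mono fun t => ?_)
    exact ENNReal.coe_le_coe.2 (hC (Set.mem_range_self t))
  rw [← SimpleFunc.lintegral_eq_lintegral]
  refine ENNReal.le_of_forall_pos_le_add fun δ hδ _ => ?_
  obtain ⟨g, hgf, hg, hfg⟩ := f.exists_upperSemicontinuous_le_lintegral_le hfin
    (ε := (δ / 2 : NNReal)) (by simpa using hδ.ne')
  have hug (t : AddCircle (1 : ℝ)) :
      ((g t : ℝ) : EReal) + u (a + (t.toCircle : ℂ) • b) ≤ ((0 : ℝ) : EReal) := by
    have h0 : 0 ≤ -u (a + (t.toCircle : ℂ) • b) := EReal.neg_nonneg.2 (hu.2 _ (hmem t))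
    have h1 : ((g t : ℝ≥0∞) : EReal) ≤ -u (a + (t.toCircle : ℂ) • b) := by
      rw [← EReal.coe_toENNReal h0]
      exact EReal.coe_ennreal_le_coe_ennreal_iff.2
        ((ENNReal.coe_le_coe.2 (hgf t)).trans (hf t))
    have h2 : u (a + (t.toCircle : ℂ) • b) ≤ -((g t : ℝ) : EReal) := EReal.le_neg_of_le_neg h1
    refine (add_le_add_right h2 _).trans (le_of_eq ?_)
    norm_cast
    simp
  obtain ⟨ε, hε, hεδ⟩ : ∃ ε : ℝ, 0 < ε ∧ 3 * ε = (δ / 2 : NNReal) :=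
    ⟨(δ / 2 : NNReal) / 3, by positivity, by ring⟩
  obtain ⟨k, hk⟩ := exists_continuous_between (h := fun _ => 0)
    (u := fun t => ((g t : ℝ) : EReal)) ((continuous_coe_real_ereal.comp
      NNReal.continuous_coe).comp_upperSemicontinuous hg
      (EReal.coe_strictMono.monotone.comp NNReal.coe_mono)) husc continuous_const
    (fun t => EReal.coe_ne_top _) (fun t => hu.ne_top (hmem t)) hug hε
  obtain ⟨q, hq⟩ := exists_polynomial_re_near k hε
  have h1 := hu.1.le_re_of_circle one_pos hd (-q + .C ((2 * ε : ℝ) : ℂ)) (fun t => by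
    simp only [Complex.ofReal_one, one_mul]
    refine (hk t).2.le.trans ?_
    have := abs_lt.1 (hq t)
    simp only [Polynomial.eval_add, Polynomial.eval_neg, Polynomial.eval_C, Complex.add_re,
      Complex.neg_re, Complex.ofReal_re]
    norm_cast; linarith) (ζ := 0) (by simp)
  simp only [zero_smul, add_zero, Polynomial.eval_add, Polynomial.eval_neg, Polynomial.eval_C,
    Complex.add_re, Complex.neg_re, Complex.ofReal_re] at h1
  have hint {k : AddCircle (1 : ℝ) → ℝ} (hk : Continuous k) :
      Integrable k AddCircle.haarAddCircle :=
    hk.integrable_of_hasCompactSupport (HasCompactSupport.of_compactSpace _)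
  have hcq : Continuous fun t : AddCircle (1 : ℝ) => q.eval (t.toCircle : ℂ) :=
    q.continuous.comp (continuous_subtype_val.comp AddCircle.continuous_toCircle)
  have hmean : ∫ t : AddCircle (1 : ℝ), k t ∂AddCircle.haarAddCircle ≤ (q.eval 0).re + ε := by
    have h2 : ∫ t : AddCircle (1 : ℝ), ((q.eval (t.toCircle : ℂ)).re + ε)
        ∂AddCircle.haarAddCircle = (q.eval 0).re + ε := by
      rw [← integral_eval_toCircle q]
      refine (integral_add (hint (Complex.continuous_re.comp hcq)) (integrable_const _)).trans ?_
      congr 1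
      · exact integral_re (𝕜 := ℂ) (hcq.integrable_of_hasCompactSupport
          (HasCompactSupport.of_compactSpace _))
      · simp
    rw [← h2]
    exact integral_mono (hint k.continuous)
      (hint ((Complex.continuous_re.comp hcq).add continuous_const))
      fun t => by linarith [(abs_lt.1 (hq t)).2]
  have hgk (t : AddCircle (1 : ℝ)) : (g t : ℝ) < k t := by exact_mod_cast (hk t).1
  have hg' : ∫⁻ t, (g t : ℝ≥0∞) ∂AddCircle.haarAddCircle ≤
      (-u a).toENNReal + (δ / 2 : NNReal) := by
    calc ∫⁻ t, (g t : ℝ≥0∞) ∂AddCircle.haarAddCircle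
        ≤ ∫⁻ t, ENNReal.ofReal (k t) ∂AddCircle.haarAddCircle := lintegral_mono fun t => by
          rw [← ENNReal.ofReal_coe_nnreal]
          exact ENNReal.ofReal_le_ofReal (hgk t).le
      _ = ENNReal.ofReal (∫ t, k t ∂AddCircle.haarAddCircle) :=
          (ofReal_integral_eq_lintegral_ofReal (hint k.continuous)
            (.of_forall fun t => (g t).2.trans (hgk t).le)).symm
      _ ≤ ENNReal.ofReal (((q.eval 0).re - 2 * ε) + (δ / 2 : NNReal)) :=
          ENNReal.ofReal_le_ofReal (by linarith)
      _ ≤ ENNReal.ofReal ((q.eval 0).re - 2 * ε) + ENNReal.ofReal (δ / 2 : NNReal) :=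
          ENNReal.ofReal_add_le
      _ ≤ (-u a).toENNReal + (δ / 2 : NNReal) := by
          rw [ENNReal.ofReal_coe_nnreal]
          gcongr
          rw [← EReal.real_coe_toENNReal]
          refine EReal.toENNReal_le_toENNReal (EReal.le_neg_of_le_neg (h1.trans (le_of_eq ?_)))
          norm_cast; ring_nf
  calc _ = ∫⁻ t, (f t : ℝ≥0∞) ∂AddCircle.haarAddCircle := by simp
    _ ≤ ∫⁻ t, (g t : ℝ≥0∞) ∂AddCircle.haarAddCircle + (δ / 2 : NNReal) := hfg
    _ ≤ (-u a).toENNReal + (δ / 2 : NNReal) + (δ / 2 : NNReal) := by gcongr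
    _ = (-u a).toENNReal + δ := by
      rw [add_assoc, ← ENNReal.coe_add, add_halves]

end Circle

section BallMean

variable {n : ℕ} {Ω : Set (Cn n)} {u v : Cn n → EReal}

theorem measurePreserving_toCircle_smul (t : AddCircle (1 : ℝ)) :
    MeasurePreserving (fun y : Cn n => (t.toCircle : ℂ) • y) volume volume :=
  volume_preserving_pi (f := fun _ : Fin n => rotation t.toCircle)
    fun _ => (rotation t.toCircle).measurePreserving

theorem PSHNeg.measurable_indicator (hu : PSHNeg u Ω) {U : Set (Cn n)} (hU : IsOpen U)
    (hUΩ : U ⊆ Ω) : Measurable (U.indicator fun y => (-u y).toENNReal) := by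
  refine LowerSemicontinuous.measurable fun x c hc => ?_
  by_cases hx : x ∈ U
  · change c < U.indicator _ x at hc
    change ∀ᶠ y in 𝓝 x, c < U.indicator _ y
    rw [Set.indicator_of_mem hx, ← EReal.coe_ennreal_lt_coe_ennreal_iff,
      EReal.coe_toENNReal (EReal.neg_nonneg.2 (hu.2 x (hUΩ hx)))] at hc
    have h1 : ∀ᶠ y in 𝓝[Ω] x, u y < -(c : EReal) := hu.1.1 x (hUΩ hx) _ (EReal.lt_neg_comm.1 hc)
    replace h1 := h1.filter_mono (nhdsWithin_mono x hUΩ)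
    rw [hU.nhdsWithin_eq hx] at h1
    filter_upwards [h1, hU.mem_nhds hx] with y hy hyU
    rw [Set.indicator_of_mem hyU, ← EReal.coe_ennreal_lt_coe_ennreal_iff,
      EReal.coe_toENNReal (EReal.neg_nonneg.2 (hu.2 y (hUΩ hyU)))]
    exact EReal.lt_neg_comm.1 hy
  · simp [Set.indicator_of_notMem hx] at hc

/-- The sub-mean value inequality on balls (for the sup norm). -/
theorem PSHNeg.setLIntegral_ball_le (hu : PSHNeg u Ω) {x : Cn n} {r : ℝ}
    (hr : Metric.ball x r ⊆ Ω) :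
    ∫⁻ y in Metric.ball x r, (-u y).toENNReal ≤
      volume (Metric.ball (0 : Cn n) r) * (-u x).toENNReal := by
  let H : Cn n → ℝ≥0∞ := (Metric.ball x r).indicator fun y => (-u y).toENNReal
  have hH : Measurable H := hu.measurable_indicator Metric.isOpen_ball hr
  let G : Cn n → ℝ≥0∞ := fun y => H (x + y)
  have hG : Measurable G := hH.comp (measurable_const_add x)
  have hcirc (y : Cn n) : ∫⁻ t : AddCircle (1 : ℝ), G ((t.toCircle : ℂ) • y)
      ∂AddCircle.haarAddCircle ≤
      (Metric.ball (0 : Cn n) r).indicator (fun _ => (-u x).toENNReal) y := by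
    by_cases hy : y ∈ Metric.ball (0 : Cn n) r
    · rw [Set.indicator_of_mem hy]
      rw [mem_ball_zero_iff] at hy
      refine le_trans (lintegral_mono fun t => Set.indicator_le_self _ _ _)
        (hu.lintegral_circle_le (b := y) fun ζ hζ => hr ?_)
      rw [mem_ball_iff_norm, add_sub_cancel_left, norm_smul]
      exact (mul_le_of_le_one_left (norm_nonneg y) hζ).trans_lt hy
    · rw [Set.indicator_of_notMem hy]
      refine le_of_eq (lintegral_eq_zero_of_ae_eq_zero (.of_forall fun t => ?_))
      refine Set.indicator_of_notMem ?_ _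
      rw [mem_ball_iff_norm, add_sub_cancel_left, norm_smul, norm_toCircle, one_mul]
      rwa [mem_ball_zero_iff] at hy
  have hcont : Continuous fun p : AddCircle (1 : ℝ) × Cn n => (p.1.toCircle : ℂ) • p.2 :=
    ((continuous_subtype_val.comp AddCircle.continuous_toCircle).comp continuous_fst).smul
      continuous_snd
  calc ∫⁻ y in Metric.ball x r, (-u y).toENNReal
      = ∫⁻ y, H y := (lintegral_indicator measurableSet_ball _).symm
    _ = ∫⁻ y, G y := (lintegral_add_left_eq_self H x).symm
    _ = ∫⁻ _ : AddCircle (1 : ℝ), ∫⁻ y, G y ∂volume ∂AddCircle.haarAddCircle := by simp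
    _ = ∫⁻ t : AddCircle (1 : ℝ), ∫⁻ y, G ((t.toCircle : ℂ) • y) ∂volume
          ∂AddCircle.haarAddCircle :=
        lintegral_congr fun t => ((measurePreserving_toCircle_smul t).lintegral_comp hG).symm
    _ = ∫⁻ y, ∫⁻ t : AddCircle (1 : ℝ), G ((t.toCircle : ℂ) • y) ∂AddCircle.haarAddCircle :=
        lintegral_lintegral_swap (hG.comp hcont.measurable).aemeasurable
    _ ≤ ∫⁻ y, (Metric.ball (0 : Cn n) r).indicator (fun _ => (-u x).toENNReal) y :=
        lintegral_mono hcirc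
    _ = volume (Metric.ball (0 : Cn n) r) * (-u x).toENNReal := by
        rw [lintegral_indicator measurableSet_ball, setLIntegral_const, mul_comm]

/-- If `a₁`, `a₂` are exceeded by `u`, `v` at points close to `z`, then `u + v` almost exceeds
`a₁ + a₂` somewhere near `z`. -/
theorem PSHNeg.exists_le_add_of_near {z : Cn n} {a₁ a₂ b : ℝ} (hb : b < a₁ + a₂)
    {ρ : ℝ} (hρ : 0 < ρ) (hball : Metric.ball z (2 * ρ) ⊆ Ω) :
    ∃ δ > 0, ∀ u v : Cn n → EReal, PSHNeg u Ω → PSHNeg v Ω →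
      ∀ x₁ ∈ Metric.ball z δ, ∀ x₂ ∈ Metric.ball z δ,
      (a₁ : EReal) < u x₁ → (a₂ : EReal) < v x₂ →
      ∃ x ∈ Metric.ball z ρ, (b : EReal) ≤ u x + v x := by
  set d := Module.finrank ℝ (Cn n)
  have hlim : Tendsto (fun δ : ℝ => -b * (ρ - δ) ^ d) (𝓝[>] 0) (𝓝 (-b * ρ ^ d)) := by
    have : Continuous fun δ : ℝ => -b * (ρ - δ) ^ d := by fun_prop
    simpa using (this.tendsto 0).mono_left nhdsWithin_le_nhds
  obtain ⟨δ, h1, hδ0, hδρ⟩ := ((hlim.eventually_const_lt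
    (show (-a₁ - a₂) * ρ ^ d < -b * ρ ^ d by gcongr; linarith)).and
      (Ioo_mem_nhdsGT hρ)).exists
  refine ⟨δ, hδ0, fun u v hu hv x₁ hx₁ x₂ hx₂ hux hvx => ?_⟩
  by_contra! hcon
  have hsub {x : Cn n} (hx : x ∈ Metric.ball z δ) : Metric.ball x ρ ⊆ Ω :=
    (Metric.ball_subset_ball' (by linarith [Metric.mem_ball.1 hx])).trans hball
  have hsub' {x : Cn n} (hx : x ∈ Metric.ball z δ) :
      Metric.ball z (ρ - δ) ⊆ Metric.ball x ρ :=
    Metric.ball_subset_ball' (by rw [dist_comm]; linarith [Metric.mem_ball.1 hx])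
  have hzρ : Metric.ball z (ρ - δ) ⊆ Metric.ball z ρ := Metric.ball_subset_ball (by linarith)
  have hmemΩ {x : Cn n} (hx : x ∈ Metric.ball z (ρ - δ)) : x ∈ Ω := hsub hx₁ (hsub' hx₁ hx)
  have ha₁ : a₁ < 0 := by
    exact_mod_cast hux.trans_le (hu.2 x₁ (hsub hx₁ (Metric.mem_ball_self hρ)))
  have ha₂ : a₂ < 0 := by
    exact_mod_cast hvx.trans_le (hv.2 x₂ (hsub hx₂ (Metric.mem_ball_self hρ)))
  have hmeas : AEMeasurable (fun y => (-u y).toENNReal)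
      (volume.restrict (Metric.ball z (ρ - δ))) :=
    (aemeasurable_indicator_iff measurableSet_ball).1
      (hu.measurable_indicator Metric.isOpen_ball fun _ => hmemΩ).aemeasurable
  have hneg {w : Cn n → EReal} {x : Cn n} {a : ℝ} (h : (a : EReal) < w x) :
      (-w x).toENNReal ≤ ENNReal.ofReal (-a) := by
    rw [← EReal.real_coe_toENNReal, EReal.coe_neg]
    exact EReal.toENNReal_le_toENNReal (EReal.neg_le_neg_iff.2 h.le)
  have key : ENNReal.ofReal (-b) * volume (Metric.ball z (ρ - δ)) ≤
      ENNReal.ofReal (-a₁ - a₂) * volume (Metric.ball (0 : Cn n) ρ) := by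
    calc ENNReal.ofReal (-b) * volume (Metric.ball z (ρ - δ))
        = ∫⁻ _ in Metric.ball z (ρ - δ), ENNReal.ofReal (-b) := by rw [setLIntegral_const]
      _ ≤ ∫⁻ y in Metric.ball z (ρ - δ), ((-u y).toENNReal + (-v y).toENNReal) := by
          refine setLIntegral_mono' measurableSet_ball fun y hy => ?_
          rw [← EReal.toENNReal_add (EReal.neg_nonneg.2 (hu.2 y (hmemΩ hy)))
            (EReal.neg_nonneg.2 (hv.2 y (hmemΩ hy))), ← EReal.real_coe_toENNReal, EReal.coe_neg,
            ← sub_eq_add_neg, ← EReal.neg_add (.inr (hv.ne_top (hmemΩ hy)))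
              (.inl (hu.ne_top (hmemΩ hy)))]
          exact EReal.toENNReal_le_toENNReal (EReal.neg_le_neg_iff.2 (hcon y (hzρ hy)).le)
      _ = (∫⁻ y in Metric.ball z (ρ - δ), (-u y).toENNReal) +
          ∫⁻ y in Metric.ball z (ρ - δ), (-v y).toENNReal := lintegral_add_left' hmeas _
      _ ≤ (∫⁻ y in Metric.ball x₁ ρ, (-u y).toENNReal) +
          ∫⁻ y in Metric.ball x₂ ρ, (-v y).toENNReal :=
          add_le_add (lintegral_mono_set (hsub' hx₁)) (lintegral_mono_set (hsub' hx₂))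
      _ ≤ volume (Metric.ball (0 : Cn n) ρ) * ENNReal.ofReal (-a₁) +
          volume (Metric.ball (0 : Cn n) ρ) * ENNReal.ofReal (-a₂) :=
          add_le_add ((hu.setLIntegral_ball_le (hsub hx₁)).trans (by gcongr; exact hneg hux))
            ((hv.setLIntegral_ball_le (hsub hx₂)).trans (by gcongr; exact hneg hvx))
      _ = ENNReal.ofReal (-a₁ - a₂) * volume (Metric.ball (0 : Cn n) ρ) := by
          rw [← mul_add, ← ENNReal.ofReal_add (by linarith) (by linarith), mul_comm,
            ← sub_eq_add_neg]
  rw [Measure.addHaar_ball_of_pos volume z (sub_pos.2 hδρ),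
    Measure.addHaar_ball_of_pos volume 0 hρ, ← mul_assoc, ← mul_assoc,
    ENNReal.mul_le_mul_iff_left (Metric.measure_ball_pos volume _ one_pos).ne'
      measure_ball_lt_top.ne,
    ← ENNReal.ofReal_mul (by linarith), ← ENNReal.ofReal_mul (by linarith),
    ENNReal.ofReal_le_ofReal_iff (by have := pow_pos hρ d; nlinarith)] at key
  linarith

/-- The usc regularization of suprema is superadditive on families of negative psh functions. -/
theorem uscReg_iSup_add_le (hΩ : IsOpen Ω) {A B G : Set (Cn n → EReal)}
    (hA : ∀ u ∈ A, PSHNeg u Ω) (hB : ∀ v ∈ B, PSHNeg v Ω)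
    (hG : ∀ u ∈ A, ∀ v ∈ B, (fun x => u x + v x) ∈ G) {z : Cn n} (hz : z ∈ Ω) :
    uscReg (fun x => ⨆ u ∈ A, u x) Ω z + uscReg (fun x => ⨆ v ∈ B, v x) Ω z ≤
      uscReg (fun x => ⨆ w ∈ G, w x) Ω z := by
  refine EReal.add_le_of_forall_lt fun a₁ h₁ a₂ h₂ => ?_
  induction a₁ with
  | bot => simp
  | top => exact absurd h₁ not_top_lt
  | coe a₁ =>
  induction a₂ with
  | bot => simp
  | top => exact absurd h₂ not_top_lt
  | coe a₂ =>
  have h₁ := frequently_lt_of_lt_limsup (by isBoundedDefault) h₁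
  have h₂ := frequently_lt_of_lt_limsup (by isBoundedDefault) h₂
  rw [← EReal.ge_of_forall_gt_iff_ge]
  intro b hb
  refine le_limsup_of_frequently_le ?_
  rw [hΩ.nhdsWithin_eq hz] at *
  rw [Metric.nhds_basis_ball.frequently_iff] at *
  intro ε hε
  obtain ⟨r, hr, hrΩ⟩ := Metric.isOpen_iff.1 hΩ z hz
  have hρ : 0 < min ε (r / 2) := by positivity
  obtain ⟨δ, hδ, H⟩ := PSHNeg.exists_le_add_of_near (a₁ := a₁) (a₂ := a₂)
    (by exact_mod_cast hb) hρ
    ((Metric.ball_subset_ball (by linarith [min_le_right ε (r / 2)])).trans hrΩ)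
  obtain ⟨x₁, hx₁, h₁⟩ := h₁ δ hδ
  obtain ⟨x₂, hx₂, h₂⟩ := h₂ δ hδ
  simp only [lt_iSup_iff] at h₁ h₂
  obtain ⟨u, hu, h₁⟩ := h₁
  obtain ⟨v, hv, h₂⟩ := h₂
  obtain ⟨x, hx, hle⟩ := H u v (hA u hu) (hB v hv) x₁ hx₁ x₂ hx₂ h₁ h₂
  exact ⟨x, Metric.ball_subset_ball (min_le_left _ _) hx,
    hle.trans (le_iSup₂_of_le _ (hG u hu v hv) le_rfl)⟩

end BallMean

section Residual

variable {E : Type*} [NormedAddCommGroup E] {Ω : Set E}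

theorem uscReg_mono {f g : E → EReal} (h : ∀ x ∈ Ω, f x ≤ g x) (z : E) :
    uscReg f Ω z ≤ uscReg g Ω z :=
  limsup_le_limsup (eventually_nhdsWithin_of_forall h)

theorem le_uscReg (f : E → EReal) {z : E} (hz : z ∈ Ω) : f z ≤ uscReg f Ω z :=
  le_limsup_of_frequently_le fun h => h.self_of_nhdsWithin hz le_rfl

theorem uscReg_le_of_usc {f g : E → EReal} (hg : UpperSemicontinuousOn g Ω)
    (h : ∀ x ∈ Ω, f x ≤ g x) {z : E} (hz : z ∈ Ω) : uscReg f Ω z ≤ g z := by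
  refine le_of_forall_gt_imp_ge_of_dense fun c hc => ?_
  refine limsup_le_of_le (by isBoundedDefault) ?_
  filter_upwards [hg z hz c hc, self_mem_nhdsWithin] with x hx hxΩ
  exact (h x hxΩ).trans hx.le

variable [NormedSpace ℂ E] {φ ψ u : E → EReal}

theorem gp_mono_of_le_add (h : ∃ C : ℝ, ∀ z ∈ Ω, φ z ≤ ψ z + (C : EReal)) (z : E) :
    gp φ Ω z ≤ gp ψ Ω z := by
  obtain ⟨C, hC⟩ := h
  refine uscReg_mono (fun x _ => iSup₂_le fun w hw => ?_) z
  obtain ⟨hw, D, hD⟩ := hw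
  have hw' : ∀ y ∈ Ω, w y ≤ ψ y + ((C + D : ℝ) : EReal) := fun y hy => (hD y hy).trans ?_
  · exact le_iSup₂_of_le w ⟨hw, C + D, hw'⟩ le_rfl
  rw [EReal.coe_add, ← add_assoc]
  gcongr
  exact hC y hy

theorem le_gp (hu : PSHNeg u Ω) {C : ℝ} (h : ∀ x ∈ Ω, u x ≤ φ x + (C : EReal)) {z : E}
    (hz : z ∈ Ω) : u z ≤ gp φ Ω z := by
  refine le_trans ?_ (le_uscReg _ hz)
  exact le_iSup₂_of_le u ⟨hu, C, h⟩ le_rfl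

theorem gp_rooftop_le (hφ : PlurisubharmonicOn φ Ω) (hψ : PlurisubharmonicOn ψ Ω) (z : E) :
    gp (Rooftop φ ψ Ω) Ω z ≤ Rooftop (gp φ Ω) (gp ψ Ω) Ω z := by
  refine uscReg_mono (fun x _ => iSup₂_le ?_) z
  rintro w ⟨hw, C, hC⟩
  have h1 {y : E} (hy : y ∈ Ω) : Rooftop φ ψ Ω y ≤ φ y :=
    uscReg_le_of_usc hφ.1 (fun x hx => iSup₂_le fun v hv => (hv.2 x hx).trans (min_le_left _ _)) hy
  have h2 {y : E} (hy : y ∈ Ω) : Rooftop φ ψ Ω y ≤ ψ y :=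
    uscReg_le_of_usc hψ.1 (fun x hx => iSup₂_le fun v hv => (hv.2 x hx).trans (min_le_right _ _)) hy
  refine le_iSup₂_of_le w ⟨hw.1, fun y hy => le_min ?_ ?_⟩ le_rfl
  · exact le_gp hw (fun x hx => (hC x hx).trans (by gcongr; exact h1 hx)) hy
  · exact le_gp hw (fun x hx => (hC x hx).trans (by gcongr; exact h2 hx)) hy

/-- Multiplication by a positive real as an order isomorphism of `EReal`. -/
def ERealMulIso (c : ℝ) (hc : 0 < c) : EReal ≃o EReal where
  toFun x := c * x
  invFun x := (c⁻¹ : ℝ) * x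
  left_inv x := by
    change ((c⁻¹ : ℝ) : EReal) * ((c : EReal) * x) = x
    rw [← mul_assoc, ← EReal.coe_mul, inv_mul_cancel₀ hc.ne', EReal.coe_one, one_mul]
  right_inv x := by
    change (c : EReal) * (((c⁻¹ : ℝ) : EReal) * x) = x
    rw [← mul_assoc, ← EReal.coe_mul, mul_inv_cancel₀ hc.ne', EReal.coe_one, one_mul]
  map_rel_iff' {x y} := by
    refine ⟨fun h => ?_, fun h => mul_le_mul_of_nonneg_left h (by exact_mod_cast hc.le)⟩
    have := mul_le_mul_of_nonneg_left (a := ((c⁻¹ : ℝ) : EReal)) h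
      (by exact_mod_cast (inv_pos.2 hc).le)
    simpa only [Equiv.coe_fn_mk, ← mul_assoc, ← EReal.coe_mul, inv_mul_cancel₀ hc.ne',
      EReal.coe_one, one_mul] using this

theorem PSHNeg.const_mul (hu : PSHNeg u Ω) {c : ℝ} (hc : 0 < c) :
    PSHNeg (fun x => (c : EReal) * u x) Ω := by
  refine ⟨⟨?_, ?_⟩, fun z hz => mul_nonpos_of_nonneg_of_nonpos (by exact_mod_cast hc.le)
    (hu.2 z hz)⟩
  · exact (ERealMulIso c hc).continuous.comp_upperSemicontinuousOn hu.1.1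
      (ERealMulIso c hc).monotone
  · intro a b r hr hd p hp ζ hζ
    have hle (ξ : ℂ) : (c : EReal) * u (a + ξ • b) ≤ ((p.eval ξ).re : EReal) ↔
        u (a + ξ • b) ≤ (((.C ((c⁻¹ : ℝ) : ℂ) * p : Polynomial ℂ).eval ξ).re : EReal) := by
      rw [Polynomial.eval_mul, Polynomial.eval_C, Complex.re_ofReal_mul, EReal.coe_mul]
      exact ((ERealMulIso c hc).le_symm_apply).symm
    simp only [hle] at hp ⊢
    exact hu.1.2 a b r hr hd _ hp ζ hζ

theorem const_mul_gp_le {c : ℝ} (hc : 0 < c) (z : E) :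
    (c : EReal) * gp φ Ω z ≤ gp (fun x => (c : EReal) * φ x) Ω z := by
  change ERealMulIso c hc (limsup _ _) ≤ _
  rw [OrderIso.limsup_apply]
  refine uscReg_mono (fun x _ => ?_) z
  simp only [OrderIso.map_iSup]
  refine iSup₂_le fun w hw => ?_
  obtain ⟨hw, C, hC⟩ := hw
  refine le_iSup₂_of_le (fun y => (c : EReal) * w y) ⟨hw.const_mul hc, c * C, fun y hy => ?_⟩ le_rfl
  rw [EReal.coe_mul, ← EReal.left_distrib_of_nonneg_of_ne_top (by exact_mod_cast hc.le)
    (EReal.coe_ne_top c)]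
  exact (ERealMulIso c hc).monotone (hC y hy)

theorem gp_const_mul {c : ℝ} (hc : 0 < c) (z : E) :
    gp (fun x => (c : EReal) * φ x) Ω z = (c : EReal) * gp φ Ω z := by
  refine le_antisymm ?_ (const_mul_gp_le hc z)
  refine ((ERealMulIso c hc).symm_apply_le).1 ?_
  refine (const_mul_gp_le (inv_pos.2 hc) z).trans (le_of_eq ?_)
  simp only [← mul_assoc, ← EReal.coe_mul, inv_mul_cancel₀ hc.ne', EReal.coe_one, one_mul]

end Residual

theorem gp_add_le {n : ℕ} {Ω : Set (Cn n)} (hΩ : IsOpen Ω) {φ ψ : Cn n → EReal} {z : Cn n}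
    (hz : z ∈ Ω) : gp φ Ω z + gp ψ Ω z ≤ gp (fun x => φ x + ψ x) Ω z := by
  refine uscReg_iSup_add_le hΩ (fun u hu => hu.1) (fun v hv => hv.1) ?_ hz
  rintro u ⟨hu, C, hC⟩ v ⟨hv, D, hD⟩
  refine ⟨hu.add hv, C + D, fun x hx => (add_le_add (hC x hx) (hD x hx)).trans (le_of_eq ?_)⟩
  rw [EReal.coe_add, add_add_add_comm]


/-- Proposition 3.3: elementary properties of the Green–Poisson residual function. -/
theorem statement2 {n : ℕ} (Ω : Set (Cn n)) (hΩconn : IsConnected Ω) (hΩopen : IsOpen Ω)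
    (hΩbd : Bornology.IsBounded Ω) (hΩbr : BRegular Ω)
    (φ ψ : Cn n → EReal) (hφ : PSHNeg φ Ω) (hψ : PSHNeg ψ Ω) :
    -- (i) `g_{cφ} = c·g_φ` for `c > 0`
    (∀ c : ℝ, 0 < c →
      ∀ z ∈ Ω, gp (fun x => (c : EReal) * φ x) Ω z = (c : EReal) * gp φ Ω z) ∧
    -- (ii) if `φ ≼ ψ` then `g_φ ≤ g_ψ`
    ((∃ C : ℝ, ∀ z ∈ Ω, φ z ≤ ψ z + (C : EReal)) → ∀ z ∈ Ω, gp φ Ω z ≤ gp ψ Ω z) ∧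
    -- (iii) `g_{φ+ψ} ≥ g_φ + g_ψ`
    (∀ z ∈ Ω, gp φ Ω z + gp ψ Ω z ≤ gp (fun x => φ x + ψ x) Ω z) ∧
    -- (iv) `g_{max{φ,ψ}} ≥ max{g_φ, g_ψ}`
    (∀ z ∈ Ω, max (gp φ Ω z) (gp ψ Ω z) ≤ gp (fun x => max (φ x) (ψ x)) Ω z) ∧
    -- (v) `g_{P(φ,ψ)} ≤ P(g_φ, g_ψ)`
    (∀ z ∈ Ω, gp (Rooftop φ ψ Ω) Ω z ≤ Rooftop (gp φ Ω) (gp ψ Ω) Ω z) := by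
  refine ⟨fun c hc z _ => gp_const_mul hc z, fun h z _ => gp_mono_of_le_add h z,
    fun z hz => gp_add_le hΩopen hz, fun z _ => max_le ?_ ?_,
    fun z _ => gp_rooftop_le hφ.1 hψ.1 z⟩
  · exact gp_mono_of_le_add ⟨0, fun x _ => by simp⟩ z
  · exact gp_mono_of_le_add ⟨0, fun x _ => by simp⟩ z
end
end

section
/- Let D ⊂ ℂⁿ be a bounded B-regular domain and H ∈ PSH⁻(D) a maximal psh function. Then g_H = g_H^b. -/
open MeasureTheory Filter Topology
open scoped ENNReal

noncomputable section

theorem EReal.add_coe_neg_le_iff (a b : EReal) (c : ℝ) :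
    a + ((-c : ℝ) : EReal) ≤ b ↔ a ≤ b + (c : EReal) := by
  rw [EReal.coe_neg, ← sub_eq_add_neg]
  exact EReal.sub_le_iff_le_add (Or.inl (EReal.coe_ne_bot c)) (Or.inl (EReal.coe_ne_top c))

theorem EReal.continuous_add_coe (c : ℝ) : Continuous fun a : EReal => a + (c : EReal) :=
  continuous_iff_continuousAt.2 fun a =>
    (EReal.continuousAt_add (p := (a, (c : EReal))) (Or.inr (EReal.coe_ne_bot c))
      (Or.inr (EReal.coe_ne_top c))).comp (f := fun a : EReal => (a, (c : EReal)))
      (by fun_prop)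

theorem PlurisubharmonicOn.add_neg_const {E : Type*} [NormedAddCommGroup E] [NormedSpace ℂ E]
    {u : E → EReal} {Ω : Set E} (hu : PlurisubharmonicOn u Ω) (c : ℝ) :
    PlurisubharmonicOn (fun z => u z + ((-c : ℝ) : EReal)) Ω := by
  refine ⟨(EReal.continuous_add_coe (-c)).comp_upperSemicontinuousOn hu.1
    fun _ _ h => add_le_add_left h _, fun a b r hr hdisc p hp ζ hζ => ?_⟩
  have key : ∀ ζ : ℂ, u (a + ζ • b) + ((-c : ℝ) : EReal) ≤ ((Polynomial.eval ζ p).re : EReal) ↔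
      u (a + ζ • b) ≤ ((Polynomial.eval ζ (p + Polynomial.C (c : ℂ))).re : EReal) := fun ζ => by
    rw [EReal.add_coe_neg_le_iff]
    simp
  exact (key ζ).2 (hu.2 a b r hr hdisc _ (fun ξ hξ => (key ξ).1 (hp ξ hξ)) ζ hζ)

/-- A psh function dominated near `∂Ω` by a maximal psh function up to an additive constant is
dominated on all of `Ω` up to the same constant. -/
theorem MaximalOn.le_add_const {E : Type*} [NormedAddCommGroup E] [NormedSpace ℂ E]
    [ProperSpace E] {Ω U : Set E} {H w : E → EReal} {C : ℝ} (hΩ : IsOpen Ω)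
    (hΩbd : Bornology.IsBounded Ω) (hH : MaximalOn H Ω) (hw : PlurisubharmonicOn w Ω)
    (hU : IsOpen U) (hfr : frontier Ω ⊆ U) (hle : ∀ x ∈ U ∩ Ω, w x ≤ H x + (C : EReal)) :
    ∀ x ∈ Ω, w x ≤ H x + (C : EReal) := by
  have hK : IsCompact (closure Ω \ U) := hΩbd.isCompact_closure.diff hU
  have hKΩ : closure Ω \ U ⊆ Ω := by
    rintro x ⟨hx, hxU⟩
    by_contra hxΩ
    exact hxU (hfr ⟨hx, by rwa [hΩ.interior_eq]⟩)
  obtain ⟨G, hG, hKG, hGΩ, hGc⟩ := exists_open_between_and_isCompact_closure hK hΩ hKΩ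
  intro x hx
  by_cases hxU : x ∈ U
  · exact hle x ⟨hxU, hx⟩
  refine (EReal.add_coe_neg_le_iff _ _ _).1 (hH.2 G hG hGc hGΩ Ω hΩ hGΩ _ (hw.add_neg_const C)
    (fun z hz => ?_) x (hKG ⟨subset_closure hx, hxU⟩))
  have hzΩ : z ∈ Ω := hGΩ (frontier_subset_closure hz)
  have hzG : z ∉ G := fun h => hz.2 (by rwa [hG.interior_eq])
  have hzU : z ∈ U := by
    by_contra h
    exact hzG (hKG ⟨subset_closure hzΩ, h⟩)
  exact (EReal.add_coe_neg_le_iff _ _ _).2 (hle z ⟨hzU, hzΩ⟩)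

/-- Proposition 4.4: for a maximal negative psh function `H`, the Green–Poisson residual
function coincides with the residual Poisson function: `g_H = g_H^b`. -/
theorem statement9 {n : ℕ} (Ω : Set (Cn n)) (hΩconn : IsConnected Ω) (hΩopen : IsOpen Ω)
    (hΩbd : Bornology.IsBounded Ω) (hΩbr : BRegular Ω)
    (H : Cn n → EReal) (hH : PSHNeg H Ω) (hHmax : MaximalOn H Ω) :
    Set.EqOn (gp H Ω) (gpB H Ω) Ω := by
  have hclass : {w : Cn n → EReal | PSHNeg w Ω ∧ ∃ C : ℝ, ∀ x ∈ Ω, w x ≤ H x + (C : EReal)} =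
      {w : Cn n → EReal | PSHNeg w Ω ∧ ∃ U : Set (Cn n), IsOpen U ∧ frontier Ω ⊆ U ∧
        ∃ C : ℝ, ∀ x ∈ U ∩ Ω, w x ≤ H x + (C : EReal)} := by
    ext w
    constructor
    · rintro ⟨hw, C, hC⟩
      exact ⟨hw, Set.univ, isOpen_univ, Set.subset_univ _, C, fun x hx => hC x hx.2⟩
    · rintro ⟨hw, U, hU, hfr, C, hC⟩
      exact ⟨hw, C, hHmax.le_add_const hΩopen hΩbd hw.1 hU hfr hC⟩
  intro z _
  rw [gp, gpB, hclass]
end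
end
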